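/- Let P₁ →a L →d₁ Q →b P₂ and R₁ →c Z →d₂ Q →e R₂ be two sequences of ℚ-vector spaces and linear maps, each exact at its second and third terms (ker d₁ = range a, ker b = range d₁, ker d₂ = range c, ker e = range d₂). Suppose each space carries a distinguished subspace W with which all six maps are compatible, and suppose a, d₁, c, d₂ are strict, i.e. a(P₁) ∩ W_L = a(W_{P₁}), d₁(L) ∩ W_Q = d₁(W_L), c(R₁) ∩ W_Z = c(W_{R₁}), d₂(Z) ∩ W_Q = d₂(W_Z). If W_{P₁} = 0, W_{P₂} = 0, W_{R₁} = 0 and W_{R₂} = 0, then d₁ restricts to an isomorphism W_L ≅ W_Q, d₂ restricts to an isomorphism W_Z ≅ W_Q, and consequently W_L and W_Z are isomorphic as ℚ-vector spaces. -/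

import Mathlib

theorem LinearMap.exists_linearEquiv_of_disjoint_ker_of_map_eq {R M N : Type*} [Ring R]
    [AddCommGroup M] [Module R M] [AddCommGroup N] [Module R N] (f : M →ₗ[R] N)
    {p : Submodule R M} {q : Submodule R N} (hker : Disjoint (LinearMap.ker f) p)
    (hmap : p.map f = q) :
    ∃ e : p ≃ₗ[R] q, ∀ x : p, (e x : N) = f (x : M) := by
  subst hmap
  refine ⟨LinearEquiv.ofBijective (f.submoduleMap p) ⟨?_, f.submoduleMap_surjective p⟩,
    fun _ => rfl⟩
  refine (injective_iff_map_eq_zero _).2 fun x hx => Subtype.ext ?_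
  exact Submodule.disjoint_def.1 hker x (congrArg Subtype.val hx) x.2

/-- In a four-term exact sequence `A → B → C → D` whose first two maps are strict and whose
outer terms have zero distinguished subspace, the middle map restricts to an isomorphism of
distinguished subspaces. -/
theorem LinearMap.exists_linearEquiv_of_exact_of_strict {R A B C D : Type*} [Ring R]
    [AddCommGroup A] [Module R A] [AddCommGroup B] [Module R B]
    [AddCommGroup C] [Module R C] [AddCommGroup D] [Module R D]
    {f : A →ₗ[R] B} {g : B →ₗ[R] C} {h : C →ₗ[R] D}
    (hfg : LinearMap.ker g = LinearMap.range f) (hgh : LinearMap.ker h = LinearMap.range g)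
    {p : Submodule R B} {q : Submodule R C}
    (hf : LinearMap.range f ⊓ p = Submodule.map f ⊥)
    (hg : LinearMap.range g ⊓ q = Submodule.map g p)
    (hh : Submodule.map h q ≤ ⊥) :
    ∃ e : p ≃ₗ[R] q, ∀ x : p, (e x : C) = g (x : B) := by
  refine g.exists_linearEquiv_of_disjoint_ker_of_map_eq ?_ ?_
  · rw [disjoint_iff, hfg, hf, Submodule.map_bot]
  · rw [← hg, inf_eq_right, ← hgh]
    exact Submodule.map_le_iff_le_comap.1 hh


/-- Abstract form of Proposition 5.1: two four-term exact sequences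
`P₁ → L → Q → P₂` and `R₁ → Z → Q → R₂` of `ℚ`-vector spaces with a common
third term `Q`, with distinguished subspaces `W` compatible with all maps,
with `a, d₁, c, d₂` strict and `W_{P₁} = W_{P₂} = W_{R₁} = W_{R₂} = 0`,
yield isomorphisms `W_L ≃ W_Q` and `W_Z ≃ W_Q` restricted from `d₁` and `d₂`,
hence `W_L ≃ W_Z`. -/
theorem three_descriptions_of_lower_weight_part
    {P₁ L Q P₂ R₁ Z R₂ : Type*}
    [AddCommGroup P₁] [Module ℚ P₁] [AddCommGroup L] [Module ℚ L]
    [AddCommGroup Q] [Module ℚ Q] [AddCommGroup P₂] [Module ℚ P₂]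
    [AddCommGroup R₁] [Module ℚ R₁] [AddCommGroup Z] [Module ℚ Z]
    [AddCommGroup R₂] [Module ℚ R₂]
    (a : P₁ →ₗ[ℚ] L) (d₁ : L →ₗ[ℚ] Q) (b : Q →ₗ[ℚ] P₂)
    (c : R₁ →ₗ[ℚ] Z) (d₂ : Z →ₗ[ℚ] Q) (e : Q →ₗ[ℚ] R₂)
    (hexL : LinearMap.ker d₁ = LinearMap.range a)
    (hexQ₁ : LinearMap.ker b = LinearMap.range d₁)
    (hexZ : LinearMap.ker d₂ = LinearMap.range c)
    (hexQ₂ : LinearMap.ker e = LinearMap.range d₂)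
    (WP₁ : Submodule ℚ P₁) (WL : Submodule ℚ L) (WQ : Submodule ℚ Q)
    (WP₂ : Submodule ℚ P₂) (WR₁ : Submodule ℚ R₁) (WZ : Submodule ℚ Z)
    (WR₂ : Submodule ℚ R₂)
    (haW : Submodule.map a WP₁ ≤ WL)
    (hd₁W : Submodule.map d₁ WL ≤ WQ)
    (hbW : Submodule.map b WQ ≤ WP₂)
    (hcW : Submodule.map c WR₁ ≤ WZ)
    (hd₂W : Submodule.map d₂ WZ ≤ WQ)
    (heW : Submodule.map e WQ ≤ WR₂)
    (has : LinearMap.range a ⊓ WL = Submodule.map a WP₁)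
    (hd₁s : LinearMap.range d₁ ⊓ WQ = Submodule.map d₁ WL)
    (hcs : LinearMap.range c ⊓ WZ = Submodule.map c WR₁)
    (hd₂s : LinearMap.range d₂ ⊓ WQ = Submodule.map d₂ WZ)
    (hWP₁ : WP₁ = ⊥) (hWP₂ : WP₂ = ⊥) (hWR₁ : WR₁ = ⊥) (hWR₂ : WR₂ = ⊥) :
    (∃ e₁ : WL ≃ₗ[ℚ] WQ, ∀ x : WL, (e₁ x : Q) = d₁ (x : L)) ∧
    (∃ e₂ : WZ ≃ₗ[ℚ] WQ, ∀ x : WZ, (e₂ x : Q) = d₂ (x : Z)) ∧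
    Nonempty (WL ≃ₗ[ℚ] WZ) := by
  subst hWP₁ hWP₂ hWR₁ hWR₂
  obtain ⟨e₁, he₁⟩ := LinearMap.exists_linearEquiv_of_exact_of_strict hexL hexQ₁ has hd₁s hbW
  obtain ⟨e₂, he₂⟩ := LinearMap.exists_linearEquiv_of_exact_of_strict hexZ hexQ₂ hcs hd₂s heW
  exact ⟨⟨e₁, he₁⟩, ⟨e₂, he₂⟩, ⟨e₁.trans e₂.symm⟩⟩
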